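/- arXiv:math/0206167 — 2 statements merged into one kernel-verified Lean document; each statement's English description precedes it below -/
import Mathlib

section
/- Let n be a positive integer and let π be a partition in NC^B(n). Then the collection of sets Abs(X), where X ranges over the blocks of π, forms a non-crossing partition of {1,...,n}; this partition is denoted Abs(π) ∈ NC^A(n). -/
open scoped Classical

namespace NCPB

/-- A collection of subsets of `α` is a partition: blocks are nonempty and
every element lies in exactly one block. -/
def IsPartition {α : Type*} (P : Set (Set α)) : Prop :=
  (∀ B ∈ P, B.Nonempty) ∧ ∀ a : α, ∃! B, B ∈ P ∧ a ∈ B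

/-- The non-crossing condition for a collection of subsets of a linear order:
if `a < b < c < d`, `a, c` lie in a block `B` and `b, d` lie in a block `C`,
then `b ∈ B` (i.e. the blocks coincide). -/
def IsNC {α : Type*} [LinearOrder α] (P : Set (Set α)) : Prop :=
  ∀ B ∈ P, ∀ C ∈ P, ∀ a b c d : α, a < b → b < c → c < d →
    a ∈ B → c ∈ B → b ∈ C → d ∈ C → b ∈ B

/-- A non-crossing partition of a linear order. -/
def NCPart {α : Type*} [LinearOrder α] (P : Set (Set α)) : Prop :=
  IsPartition P ∧ IsNC P

/-- The set `[±m] = {1 < 2 < ... < m < -1 < -2 < ... < -m}` is encoded as `Fin (2*m)`,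
position `k < m` encoding `k+1` and position `m + j` encoding `-(j+1)`.
`negMap` is the inversion map `a ↦ -a`. -/
def negMap (m : ℕ) (k : Fin (2*m)) : Fin (2*m) :=
  ⟨(k.val + m) % (2*m), Nat.mod_lt _ (Nat.lt_of_le_of_lt (Nat.zero_le _) k.isLt)⟩

/-- Image of a subset of `[±m]` under the inversion map, i.e. `X ↦ -X`. -/
def negSet (m : ℕ) (X : Set (Fin (2*m))) : Set (Fin (2*m)) := negMap m '' X

/-- The absolute value map `[±m] → {1,...,m}`, `±i ↦ i`. -/
def absMap (m : ℕ) (k : Fin (2*m)) : Fin m :=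
  ⟨k.val % m, Nat.mod_lt _ (by have := k.isLt; omega)⟩

/-- A non-crossing partition of type B: a non-crossing partition of `[±m]`
invariant under the inversion map. -/
def NCBPart (m : ℕ) (π : Set (Set (Fin (2*m)))) : Prop :=
  NCPart π ∧ ∀ B ∈ π, negSet m B ∈ π

/-- The collection of sets `Abs(X)`, `X` a block of `π`. -/
def absPart (m : ℕ) (π : Set (Set (Fin (2*m)))) : Set (Set (Fin m)) :=
  {F | ∃ X ∈ π, F = absMap m '' X}

/-- The embedding of `{1,...,m}` onto the odd-indexed positions of the interleaved
set `1 < 1̄ < 2 < 2̄ < ... < m < m̄` (encoded as `Fin (2*m)`): `i ↦ i` (even positions). -/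
def evens (m : ℕ) (i : Fin m) : Fin (2*m) := ⟨2*i.val, by have := i.isLt; omega⟩

/-- The embedding of the barred copy `{1̄,...,m̄}` into the interleaved set: odd positions. -/
def odds (m : ℕ) (i : Fin m) : Fin (2*m) := ⟨2*i.val+1, by have := i.isLt; omega⟩

/-- `P` refines... rather: every block of `P` is contained in a block of `Q`
(the partial order on partitions by reverse refinement: `P ≤ Q`). -/
def Refines {α : Type*} (P Q : Set (Set α)) : Prop := ∀ B ∈ P, ∃ C ∈ Q, B ⊆ C

/-- The collection `p ∪ q̄` of subsets of the interleaved set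
`1 < 1̄ < 2 < 2̄ < ... < m < m̄`, with `p` living on the unbarred copy and `q` on the
barred copy. -/
def interleave (m : ℕ) (p q : Set (Set (Fin m))) : Set (Set (Fin (2*m))) :=
  ((fun B => evens m '' B) '' p) ∪ ((fun B => odds m '' B) '' q)

/-- `q` is the Kreweras complement of `p`: `q` is the largest non-crossing partition
(in the reverse-refinement order) such that `p ∪ q̄` is a non-crossing partition of the
interleaved set `1 < 1̄ < ... < m < m̄`. -/
def IsKr (m : ℕ) (p q : Set (Set (Fin m))) : Prop :=
  NCPart q ∧ NCPart (interleave m p q) ∧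
  ∀ q', NCPart q' → NCPart (interleave m p q') → Refines q' q

/-- Two sets cross: there are `a < b < c < d` with `a, c ∈ B` and `b, d ∈ C`. -/
def Crossing {α : Type*} [LinearOrder α] (B C : Set α) : Prop :=
  ∃ a b c d : α, a < b ∧ b < c ∧ c < d ∧ a ∈ B ∧ c ∈ B ∧ b ∈ C ∧ d ∈ C

/-- Two members of a non-crossing family of pairwise disjoint sets: disjoint,
and neither crosses the other. -/
def PairNC {α : Type*} [LinearOrder α] (B C : Set α) : Prop :=
  Disjoint B C ∧ ¬ Crossing B C ∧ ¬ Crossing C B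

end NCPB
namespace NCPB

variable {n : ℕ}

/-- The position of the positive element `i` in `[±n]`. -/
def posIdx (i : Fin n) : Fin (2*n) := ⟨i.val, by have := i.isLt; omega⟩

/-- The position of the negative element `-i` in `[±n]`. -/
def negIdx (i : Fin n) : Fin (2*n) := ⟨i.val + n, by have := i.isLt; omega⟩

theorem negMap_posIdx (i : Fin n) : negMap n (posIdx i) = negIdx i := by
  have := i.isLt
  ext
  exact Nat.mod_eq_of_lt (by simp only [posIdx]; omega)

theorem negMap_negIdx (i : Fin n) : negMap n (negIdx i) = posIdx i := by
  have := i.isLt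
  ext
  have h : i.val + n + n = i.val + 2 * n := by omega
  simp only [negMap, negIdx, posIdx, h, Nat.add_mod_right]
  exact Nat.mod_eq_of_lt (by omega)

theorem absMap_posIdx (i : Fin n) : absMap n (posIdx i) = i :=
  Fin.ext (Nat.mod_eq_of_lt i.isLt)

theorem absMap_negIdx (i : Fin n) : absMap n (negIdx i) = i :=
  Fin.ext ((Nat.add_mod_right _ _).trans (Nat.mod_eq_of_lt i.isLt))

theorem eq_posIdx_or_eq_negIdx (k : Fin (2*n)) :
    k = posIdx (absMap n k) ∨ k = negIdx (absMap n k) := by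
  have hk := k.isLt
  rcases lt_or_ge k.val n with h | h
  · exact Or.inl (Fin.ext (Nat.mod_eq_of_lt h).symm)
  · right
    ext
    have h2 : k.val % n = k.val - n := by
      rw [Nat.mod_eq_sub_mod h, Nat.mod_eq_of_lt (by omega)]
    simp only [negIdx, absMap, h2]
    omega

theorem absMap_negMap (k : Fin (2*n)) : absMap n (negMap n k) = absMap n k := by
  rcases eq_posIdx_or_eq_negIdx k with h | h <;> rw [h]
  · rw [negMap_posIdx, absMap_negIdx, absMap_posIdx]
  · rw [negMap_negIdx, absMap_negIdx, absMap_posIdx]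

theorem absMap_image_negSet (X : Set (Fin (2*n))) :
    absMap n '' negSet n X = absMap n '' X := by
  simp only [negSet, Set.image_image, absMap_negMap]

theorem mem_absMap_image_iff {X : Set (Fin (2*n))} {i : Fin n} :
    i ∈ absMap n '' X ↔ posIdx i ∈ X ∨ negIdx i ∈ X := by
  constructor
  · rintro ⟨k, hk, rfl⟩
    rcases eq_posIdx_or_eq_negIdx k with h | h
    · exact Or.inl (h ▸ hk)
    · exact Or.inr (h ▸ hk)
  · rintro (h | h)
    · exact ⟨_, h, absMap_posIdx i⟩
    · exact ⟨_, h, absMap_negIdx i⟩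

theorem negIdx_mem_negSet {X : Set (Fin (2*n))} {i : Fin n} (h : posIdx i ∈ X) :
    negIdx i ∈ negSet n X :=
  ⟨_, h, negMap_posIdx i⟩

theorem posIdx_mem_negSet {X : Set (Fin (2*n))} {i : Fin n} (h : negIdx i ∈ X) :
    posIdx i ∈ negSet n X :=
  ⟨_, h, negMap_negIdx i⟩

/-- A member of `absPart n π` containing `i` comes from a block containing the positive `i`. -/
theorem exists_posIdx_mem_of_mem_absPart {π : Set (Set (Fin (2*n)))}
    (hπ : ∀ B ∈ π, negSet n B ∈ π) {F : Set (Fin n)} (hF : F ∈ absPart n π) {i : Fin n}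
    (hi : i ∈ F) : ∃ X ∈ π, F = absMap n '' X ∧ posIdx i ∈ X := by
  obtain ⟨X, hX, rfl⟩ := hF
  rcases mem_absMap_image_iff.1 hi with h | h
  · exact ⟨X, hX, rfl, h⟩
  · exact ⟨_, hπ X hX, (absMap_image_negSet X).symm, posIdx_mem_negSet h⟩

theorem isPartition_absPart {π : Set (Set (Fin (2*n)))} (hP : IsPartition π)
    (hπ : ∀ B ∈ π, negSet n B ∈ π) : IsPartition (absPart n π) := by
  refine ⟨?_, fun i => ?_⟩
  · rintro _ ⟨X, hX, rfl⟩
    exact (hP.1 X hX).image _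
  · obtain ⟨X, ⟨hX, hi⟩, huniq⟩ := hP.2 (posIdx i)
    refine ⟨absMap n '' X, ⟨⟨X, hX, rfl⟩, mem_absMap_image_iff.2 (Or.inl hi)⟩, ?_⟩
    rintro F ⟨hF, hiF⟩
    obtain ⟨Y, hY, rfl, hiY⟩ := exists_posIdx_mem_of_mem_absPart hπ hF hiF
    rw [huniq Y ⟨hY, hiY⟩]

theorem isNC_absPart {π : Set (Set (Fin (2*n)))} (hNC : IsNC π)
    (hπ : ∀ B ∈ π, negSet n B ∈ π) : IsNC (absPart n π) := by
  intro F hF G hG a b c d hab hbc hcd haF hcF hbG hdG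
  obtain ⟨X, hX, rfl, ha⟩ := exists_posIdx_mem_of_mem_absPart hπ hF haF
  obtain ⟨Y, hY, rfl, hb⟩ := exists_posIdx_mem_of_mem_absPart hπ hG hbG
  have pos_lt_pos {i j : Fin n} (h : i < j) : posIdx i < posIdx j := h
  have neg_lt_neg {i j : Fin n} (h : i < j) : negIdx i < negIdx j := Nat.add_lt_add_right h n
  have pos_lt_neg (i j : Fin n) : posIdx i < negIdx j :=
    Nat.lt_of_lt_of_le i.isLt (Nat.le_add_left _ _)
  rw [mem_absMap_image_iff] at hcF hdG ⊢
  rcases hcF with hc | hc <;> rcases hdG with hd | hd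
  · exact Or.inl (hNC X hX Y hY _ _ _ _ (pos_lt_pos hab) (pos_lt_pos hbc) (pos_lt_pos hcd)
      ha hc hb hd)
  · exact Or.inl (hNC X hX Y hY _ _ _ _ (pos_lt_pos hab) (pos_lt_pos hbc) (pos_lt_neg c d)
      ha hc hb hd)
  · exact Or.inr (hNC X hX _ (hπ Y hY) _ _ _ _ (pos_lt_neg a b) (neg_lt_neg hbc) (neg_lt_neg hcd)
      ha hc (negIdx_mem_negSet hb) (negIdx_mem_negSet hd))
  · exact Or.inl (hNC X hX Y hY _ _ _ _ (pos_lt_pos hab) (pos_lt_neg b c) (neg_lt_neg hcd)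
      ha hc hb hd)

end NCPB

open NCPB in
/-- If `π` is a non-crossing partition of type B of `[±n]`, then the
collection of sets `Abs(X)`, `X` a block of `π`, is a non-crossing partition of `{1,...,n}`. -/
theorem absPart_NCPart (n : ℕ) (hn : 0 < n) (π : Set (Set (Fin (2*n))))
    (hπ : NCBPart n π) : NCPart (absPart n π) :=
  ⟨isPartition_absPart hπ.1.1 hπ.2, isNC_absPart hπ.1.2 hπ.2⟩
end

section
/- If τ₁ ≤ τ₂ in W_n with respect to the partial order coming from (W_n, R_n), then the number of inversion-invariant orbits of τ₂ is at least the number of inversion-invariant orbits of τ₁. -/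
open scoped Classical

namespace NCPB

/-- The generating set `R_n` of the hyperoctahedral group: all transpositions `(i,-i)`
and all products `(i,j)(-i,-j)` with `|i| ≠ |j|`. -/
def Rn (n : ℕ) : Set (Equiv.Perm (Fin (2*n))) :=
  {ρ | (∃ i, ρ = Equiv.swap i (negMap n i)) ∨
       (∃ i j, absMap n i ≠ absMap n j ∧
          ρ = Equiv.swap i j * Equiv.swap (negMap n i) (negMap n j))}

/-- Membership in the hyperoctahedral group `W_n`: permutations of `[±n]` commuting
with the inversion map. -/
def InWn (n : ℕ) (τ : Equiv.Perm (Fin (2*n))) : Prop :=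
  ∀ k, τ (negMap n k) = negMap n (τ k)

/-- Word-length with respect to the generating set `R_n`. -/
noncomputable def lenB (n : ℕ) (τ : Equiv.Perm (Fin (2*n))) : ℕ :=
  sInf {k | ∃ l : List (Equiv.Perm (Fin (2*n))),
    (∀ ρ ∈ l, ρ ∈ Rn n) ∧ l.length = k ∧ l.prod = τ}

/-- The partial order on `W_n` coming from `(W_n, R_n)`: `a ≤ b` iff `|a| + |a⁻¹b| = |b|`. -/
def leB (n : ℕ) (a b : Equiv.Perm (Fin (2*n))) : Prop :=
  lenB n a + lenB n (a⁻¹ * b) = lenB n b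

/-- `b` covers `a` in the partial order coming from `(W_n, R_n)`. -/
def CoversB (n : ℕ) (a b : Equiv.Perm (Fin (2*n))) : Prop :=
  leB n a b ∧ lenB n b = lenB n a + 1

/-- The orbits of a permutation. -/
def orbitsOf (n : ℕ) (τ : Equiv.Perm (Fin (2*n))) : Set (Set (Fin (2*n))) :=
  {O | ∃ x, O = {y | τ.SameCycle x y}}

/-- Word-length with respect to the set of all transpositions of a symmetric group. -/
noncomputable def lenA (N : ℕ) (τ : Equiv.Perm (Fin N)) : ℕ :=
  sInf {k | ∃ l : List (Equiv.Perm (Fin N)),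
    (∀ ρ ∈ l, ρ.IsSwap) ∧ l.length = k ∧ l.prod = τ}

/-- The partial order on the symmetric group coming from all transpositions. -/
def leA (N : ℕ) (a b : Equiv.Perm (Fin N)) : Prop :=
  lenA N a + lenA N (a⁻¹ * b) = lenA N b

/-- `τ = ι(π)`: for each block `B` of `π` and `a ∈ B`, `τ a` is the cyclic successor of
`a` in `B` (the least element of `B` greater than `a`, or the least element of `B` if
`a` is the largest element of `B`). -/
def IsIota (N : ℕ) (π : Set (Set (Fin N))) (τ : Equiv.Perm (Fin N)) : Prop :=
  ∀ B ∈ π, ∀ a ∈ B,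
    ((∃ b ∈ B, a < b) → IsLeast {b | b ∈ B ∧ a < b} (τ a)) ∧
    ((∀ b ∈ B, ¬ a < b) → IsLeast B (τ a))

/-- The long inversion-invariant cycle `ω = (1, 2, ..., n, -1, -2, ..., -n)`. -/
def omegaW (n : ℕ) : Equiv.Perm (Fin (2*n)) := finRotate (2*n)

end NCPB
namespace NCPB

lemma negMap_negMap {n : ℕ} (k : Fin (2*n)) : negMap n (negMap n k) = k := by
  have hk := k.isLt
  ext
  simp only [negMap, Nat.mod_add_mod]
  rw [add_assoc, ← two_mul, Nat.add_mod_right, Nat.mod_eq_of_lt hk]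

lemma negMap_injective (n : ℕ) : Function.Injective (negMap n) :=
  Function.LeftInverse.injective negMap_negMap

lemma negMap_ne {n : ℕ} (k : Fin (2*n)) : negMap n k ≠ k := by
  have hk := k.isLt
  intro h
  have h := congrArg Fin.val h
  simp only [negMap] at h
  rcases lt_or_ge (k.val + n) (2*n) with h' | h'
  · rw [Nat.mod_eq_of_lt h'] at h; omega
  · rw [Nat.mod_eq_sub_mod h', Nat.mod_eq_of_lt (by omega)] at h; omega

lemma eq_or_eq_negMap_of_absMap_eq {n : ℕ} {i j : Fin (2*n)} (h : absMap n i = absMap n j) :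
    j = i ∨ j = negMap n i := by
  have hi := i.isLt
  have hj := j.isLt
  have h := congrArg Fin.val h
  simp only [absMap] at h
  have key : ∀ k : ℕ, k < 2 * n → k % n = k ∧ k < n ∨ k % n = k - n ∧ n ≤ k := by
    intro k hk
    rcases lt_or_ge k n with h' | h'
    · exact Or.inl ⟨Nat.mod_eq_of_lt h', h'⟩
    · exact Or.inr ⟨by rw [Nat.mod_eq_sub_mod h', Nat.mod_eq_of_lt (by omega)], h'⟩
  have hmod : (i.val + n) % (2*n) = i.val + n ∧ i.val < n ∨
      (i.val + n) % (2*n) = i.val - n ∧ n ≤ i.val := by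
    rcases lt_or_ge i.val n with h' | h'
    · exact Or.inl ⟨Nat.mod_eq_of_lt (by omega), h'⟩
    · exact Or.inr ⟨by rw [Nat.mod_eq_sub_mod (by omega), Nat.mod_eq_of_lt (by omega)]; omega, h'⟩
  have h1 := key i hi
  have h2 := key j hj
  simp only [Fin.ext_iff, negMap]
  omega

lemma InWn.mul {n : ℕ} {σ τ : Equiv.Perm (Fin (2*n))} (hσ : InWn n σ) (hτ : InWn n τ) :
    InWn n (σ * τ) := fun k => by
  simp only [Equiv.Perm.mul_apply, hτ k, hσ (τ k)]

lemma InWn.inv {n : ℕ} {τ : Equiv.Perm (Fin (2*n))} (hτ : InWn n τ) : InWn n τ⁻¹ := fun k => by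
  rw [Equiv.Perm.inv_eq_iff_eq, hτ, Equiv.Perm.inv_def, Equiv.apply_symm_apply]

lemma negMap_swap_apply {n : ℕ} (i j k : Fin (2*n)) :
    negMap n (Equiv.swap i j k) = Equiv.swap (negMap n i) (negMap n j) (negMap n k) :=
  (negMap_injective n).map_swap _ _ _

lemma swap_commute_swap_negMap {n : ℕ} {i j : Fin (2*n)} (hj : j ≠ negMap n i) :
    Equiv.swap i j * Equiv.swap (negMap n i) (negMap n j) =
      Equiv.swap (negMap n i) (negMap n j) * Equiv.swap i j := by
  have hi : negMap n j ≠ i := fun h => hj (by rw [← h, negMap_negMap])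
  rw [Equiv.mul_swap_eq_swap_mul, Equiv.swap_apply_of_ne_of_ne (negMap_ne i) hj.symm,
    Equiv.swap_apply_of_ne_of_ne hi (negMap_ne j)]

/-- The functions fixed by `τ` on which the inversion map acts as the scalar `s`. -/
def fixedSpace (n : ℕ) (s : ℚ) (τ : Equiv.Perm (Fin (2*n))) :
    Submodule ℚ (Fin (2*n) → ℚ) where
  carrier := {f | (∀ x, f (τ x) = f x) ∧ ∀ x, f (negMap n x) = s * f x}
  zero_mem' := by simp
  add_mem' := by
    rintro f g ⟨hf, hf'⟩ ⟨hg, hg'⟩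
    exact ⟨fun x => by simp [hf, hg], fun x => by simp [hf', hg', mul_add]⟩
  smul_mem' := by
    rintro c f ⟨hf, hf'⟩
    exact ⟨fun x => by simp [hf], fun x => by simp [hf', mul_left_comm]⟩

lemma mem_fixedSpace {n : ℕ} {s : ℚ} {τ : Equiv.Perm (Fin (2*n))} {f : Fin (2*n) → ℚ} :
    f ∈ fixedSpace n s τ ↔ (∀ x, f (τ x) = f x) ∧ ∀ x, f (negMap n x) = s * f x := Iff.rfl

lemma fixedSpace_le_one {n : ℕ} (s : ℚ) (τ : Equiv.Perm (Fin (2*n))) :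
    fixedSpace n s τ ≤ fixedSpace n s 1 := fun _ hf => ⟨fun _ => rfl, hf.2⟩

lemma finrank_fixedSpace_add_le {n : ℕ} (s : ℚ) (σ τ : Equiv.Perm (Fin (2*n))) :
    Module.finrank ℚ (fixedSpace n s σ) + Module.finrank ℚ (fixedSpace n s τ) ≤
      Module.finrank ℚ (fixedSpace n s 1) + Module.finrank ℚ (fixedSpace n s (σ * τ)) := by
  rw [← Submodule.finrank_sup_add_finrank_inf_eq]
  refine add_le_add
    (Submodule.finrank_mono (sup_le (fixedSpace_le_one s σ) (fixedSpace_le_one s τ)))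
    (Submodule.finrank_mono ?_)
  rintro f ⟨hσ, hτ⟩
  exact ⟨fun x => by rw [Equiv.Perm.mul_apply, hσ.1, hτ.1], hσ.2⟩

lemma apply_swap_eq {α β : Type*} [DecidableEq α] {f : α → β} {i j : α} (h : f i = f j) (x : α) :
    f (Equiv.swap i j x) = f x := by
  rw [Equiv.swap_apply_def]
  split_ifs with h1 h2
  · rw [h1, h]
  · rw [h2, h]
  · rfl

lemma finrank_le_finrank_inf_ker_add_one {V : Type*} [AddCommGroup V] [Module ℚ V]
    [FiniteDimensional ℚ V] (W : Submodule ℚ V) (φ : V →ₗ[ℚ] ℚ) :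
    Module.finrank ℚ W ≤ Module.finrank ℚ (W ⊓ LinearMap.ker φ : Submodule ℚ V) + 1 := by
  have h1 := Submodule.finrank_sup_add_finrank_inf_eq W (LinearMap.ker φ)
  have h2 := LinearMap.finrank_range_add_finrank_ker φ
  have h3 : Module.finrank ℚ (LinearMap.range φ) ≤ 1 := by
    simpa using Submodule.finrank_le (LinearMap.range φ)
  have h4 := Submodule.finrank_le (W ⊔ LinearMap.ker φ)
  omega

lemma finrank_fixedSpace_one_le_of_mem_Rn {n : ℕ} (s : ℚ) {ρ : Equiv.Perm (Fin (2*n))}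
    (hρ : ρ ∈ Rn n) :
    Module.finrank ℚ (fixedSpace n s 1) ≤ Module.finrank ℚ (fixedSpace n s ρ) + 1 := by
  obtain ⟨i, j, h⟩ : ∃ i j, ∀ f ∈ fixedSpace n s 1, f i = f j → f ∈ fixedSpace n s ρ := by
    rcases hρ with ⟨i, rfl⟩ | ⟨i, j, -, rfl⟩
    · exact ⟨i, negMap n i, fun f hf h => ⟨apply_swap_eq h, hf.2⟩⟩
    · refine ⟨i, j, fun f hf h => ⟨fun x => ?_, hf.2⟩⟩
      rw [Equiv.Perm.mul_apply, apply_swap_eq h,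
        apply_swap_eq (f := f) (i := negMap n i) (by rw [hf.2, hf.2, h])]
  refine (finrank_le_finrank_inf_ker_add_one _
    (LinearMap.proj (R := ℚ) (φ := fun _ : Fin (2*n) => ℚ) i - LinearMap.proj j)).trans
    (Nat.add_le_add_right (Submodule.finrank_mono ?_) 1)
  rintro f ⟨hf, hf'⟩
  exact h f hf (sub_eq_zero.1 hf')

lemma finrank_fixedSpace_one_le_of_list {n : ℕ} (s : ℚ) (l : List (Equiv.Perm (Fin (2*n))))
    (hl : ∀ ρ ∈ l, ρ ∈ Rn n) :
    Module.finrank ℚ (fixedSpace n s 1) ≤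
      Module.finrank ℚ (fixedSpace n s l.prod) + l.length := by
  induction l with
  | nil => exact Nat.le_add_right _ _
  | cons ρ l ih =>
    have h1 := ih fun σ hσ => hl σ (List.mem_cons_of_mem _ hσ)
    have h2 := finrank_fixedSpace_one_le_of_mem_Rn s (hl ρ List.mem_cons_self)
    have h3 := finrank_fixedSpace_add_le s ρ l.prod
    rw [List.prod_cons, List.length_cons]
    omega

/-- Any two distinct points are exchanged by an element of `R_n`. -/
lemma exists_mem_Rn_apply_eq {n : ℕ} {x y : Fin (2*n)} (hxy : y ≠ x) :
    ∃ ρ ∈ Rn n, InWn n ρ ∧ ρ * ρ = 1 ∧ ρ y = x ∧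
      ∀ f : Fin (2*n) → ℚ, f y = f x → f (negMap n y) = f (negMap n x) → ∀ z, f (ρ z) = f z := by
  by_cases h : y = negMap n x
  · subst h
    refine ⟨Equiv.swap x (negMap n x), Or.inl ⟨x, rfl⟩, fun k => ?_, Equiv.swap_mul_self _ _,
      Equiv.swap_apply_right _ _, fun f hf _ => apply_swap_eq hf.symm⟩
    rw [negMap_swap_apply, negMap_negMap, Equiv.swap_comm]
  · have hc := swap_commute_swap_negMap h
    refine ⟨Equiv.swap x y * Equiv.swap (negMap n x) (negMap n y), Or.inr ⟨x, y, fun he => ?_, rfl⟩,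
      fun k => ?_, ?_, ?_, fun f hf hf' z => ?_⟩
    · exact (eq_or_eq_negMap_of_absMap_eq he).elim hxy h
    · conv_rhs => rw [hc]
      simp only [Equiv.Perm.mul_apply, negMap_swap_apply, negMap_negMap]
    · nth_rewrite 1 [hc]
      rw [mul_assoc, ← mul_assoc (Equiv.swap x y), Equiv.swap_mul_self, one_mul,
        Equiv.swap_mul_self]
    · rw [hc, Equiv.Perm.mul_apply, Equiv.swap_apply_right,
        Equiv.swap_apply_of_ne_of_ne (negMap_ne x).symm]
      exact fun he => h (by rw [he, negMap_negMap])
    · rw [Equiv.Perm.mul_apply, apply_swap_eq hf.symm, apply_swap_eq hf'.symm]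

lemma fixedSpace_lt_of_apply_eq {n : ℕ} {τ ρ : Equiv.Perm (Fin (2*n))} {x : Fin (2*n)}
    (hle : fixedSpace n (-1) τ ≤ fixedSpace n (-1) ρ) (hρ : InWn n ρ) (hx : τ x ≠ x)
    (hρx : ρ x = x) : fixedSpace n (-1) τ < fixedSpace n (-1) ρ := by
  refine lt_of_le_of_ne hle fun he => ?_
  have hρx' : ρ (negMap n x) = negMap n x := by rw [hρ, hρx]
  have hx' : negMap n x ≠ x := negMap_ne x
  have hmem : (Pi.single x 1 - Pi.single (negMap n x) 1 : Fin (2*n) → ℚ) ∈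
      fixedSpace n (-1) ρ := by
    have hρ1 : ∀ y, ρ y = x ↔ y = x := fun y => by
      conv_lhs => rw [← hρx]
      exact ρ.injective.eq_iff
    have hρ2 : ∀ y, ρ y = negMap n x ↔ y = negMap n x := fun y => by
      conv_lhs => rw [← hρx']
      exact ρ.injective.eq_iff
    have hn : ∀ y, negMap n y = x ↔ y = negMap n x := fun y =>
      ⟨fun h => by rw [← h, negMap_negMap], fun h => by rw [h, negMap_negMap]⟩
    refine ⟨fun y => ?_, fun y => ?_⟩
    · simp only [Pi.sub_apply, Pi.single_apply, hρ1, hρ2]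
    · simp only [Pi.sub_apply, Pi.single_apply, hn, (negMap_injective n).eq_iff]
      ring
  rw [← he] at hmem
  have := hmem.1 x
  simp only [Pi.sub_apply, Pi.single_apply, if_neg hx, if_neg hx'.symm, if_true] at this
  split_ifs at this <;> norm_num at this

lemma exists_list_Rn {n : ℕ} (τ : Equiv.Perm (Fin (2*n))) (hτ : InWn n τ) :
    ∃ l : List (Equiv.Perm (Fin (2*n))), (∀ ρ ∈ l, ρ ∈ Rn n) ∧ l.prod = τ ∧
      l.length + Module.finrank ℚ (fixedSpace n (-1) τ) ≤
        Module.finrank ℚ (fixedSpace n (-1) 1) := by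
  induction hd : Module.finrank ℚ (fixedSpace n (-1) 1) -
    Module.finrank ℚ (fixedSpace n (-1) τ) using Nat.strong_induction_on generalizing τ with
  | _ d ih =>
  by_cases h1 : τ = 1
  · subst h1
    exact ⟨[], by simp⟩
  obtain ⟨x, hx⟩ : ∃ x, τ x ≠ x := by
    by_contra! h
    exact h1 (Equiv.ext h)
  obtain ⟨ρ, hρ, hρW, hρρ, hρx, hfix⟩ := exists_mem_Rn_apply_eq hx
  have hlt : fixedSpace n (-1) τ < fixedSpace n (-1) (ρ * τ) := by
    refine fixedSpace_lt_of_apply_eq (fun f hf => ⟨fun z => ?_, hf.2⟩) (hρW.mul hτ) hx hρx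
    rw [Equiv.Perm.mul_apply, hfix f (hf.1 x) (by rw [hf.2, hf.2, hf.1]), hf.1]
  have hlt' := Submodule.finrank_lt_finrank_of_lt hlt
  have hle := Submodule.finrank_mono (fixedSpace_le_one (-1) (ρ * τ))
  obtain ⟨l, hl, hprod, hlen⟩ := ih _ (by omega) (ρ * τ) (hρW.mul hτ) rfl
  refine ⟨ρ :: l, List.forall_mem_cons.2 ⟨hρ, hl⟩, ?_, ?_⟩
  · rw [List.prod_cons, hprod, ← mul_assoc, hρρ, one_mul]
  · rw [List.length_cons]
    omega

lemma lenB_add_finrank_le {n : ℕ} {τ : Equiv.Perm (Fin (2*n))} (hτ : InWn n τ) :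
    lenB n τ + Module.finrank ℚ (fixedSpace n (-1) τ) ≤
      Module.finrank ℚ (fixedSpace n (-1) 1) := by
  obtain ⟨l, hl, hprod, hlen⟩ := exists_list_Rn τ hτ
  have : lenB n τ ≤ l.length := Nat.sInf_le ⟨l, hl, rfl, hprod⟩
  omega

lemma finrank_fixedSpace_one_le {n : ℕ} (s : ℚ) {τ : Equiv.Perm (Fin (2*n))} (hτ : InWn n τ) :
    Module.finrank ℚ (fixedSpace n s 1) ≤ Module.finrank ℚ (fixedSpace n s τ) + lenB n τ := by
  obtain ⟨l, hl, hprod, -⟩ := exists_list_Rn τ hτ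
  obtain ⟨l', hl', hlen, hprod'⟩ : lenB n τ ∈ {k | ∃ l : List (Equiv.Perm (Fin (2*n))),
      (∀ ρ ∈ l, ρ ∈ Rn n) ∧ l.length = k ∧ l.prod = τ} := Nat.sInf_mem ⟨_, l, hl, rfl, hprod⟩
  rw [← hlen, ← hprod']
  exact finrank_fixedSpace_one_le_of_list s l' hl'

lemma apply_eq_of_sameCycle {α β : Type*} {τ : Equiv.Perm α} {f : α → β}
    (hf : ∀ x, f (τ x) = f x) {x y : α} (h : τ.SameCycle x y) : f x = f y := by
  obtain ⟨k, rfl⟩ := h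
  have hinv : ∀ x, f (τ⁻¹ x) = f x := fun x => by
    rw [← hf (τ⁻¹ x), Equiv.Perm.inv_def, Equiv.apply_symm_apply]
  induction k using Int.induction_on with
  | zero => rfl
  | succ k ih => rw [add_comm, zpow_one_add, Equiv.Perm.mul_apply, hf, ih]
  | pred k ih => rw [sub_eq_neg_add, zpow_add, zpow_neg_one, Equiv.Perm.mul_apply, hinv, ih]

lemma InWn.sameCycle_negMap {n : ℕ} {τ : Equiv.Perm (Fin (2*n))} (hτ : InWn n τ)
    {x y : Fin (2*n)} (h : τ.SameCycle x y) : τ.SameCycle (negMap n x) (negMap n y) := by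
  refine (apply_eq_of_sameCycle (τ := τ) (f := fun y => τ.SameCycle (negMap n x) (negMap n y))
    (fun z => ?_) h).mp (Equiv.Perm.SameCycle.refl _ _)
  rw [← hτ z, Equiv.Perm.sameCycle_apply_right]

/-- The orbit of a point. -/
def orbitOf {n : ℕ} (τ : Equiv.Perm (Fin (2*n))) (x : Fin (2*n)) : Set (Fin (2*n)) :=
  {y | τ.SameCycle x y}

lemma orbitOf_eq_iff {n : ℕ} {τ : Equiv.Perm (Fin (2*n))} {x y : Fin (2*n)} :
    orbitOf τ x = orbitOf τ y ↔ τ.SameCycle x y := by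
  refine ⟨fun h => ?_, fun h => Set.ext fun z => ⟨h.symm.trans, h.trans⟩⟩
  have : y ∈ orbitOf τ y := Equiv.Perm.SameCycle.refl _ _
  rwa [← h] at this

lemma orbitOf_apply {n : ℕ} (τ : Equiv.Perm (Fin (2*n))) (x : Fin (2*n)) :
    orbitOf τ (τ x) = orbitOf τ x :=
  orbitOf_eq_iff.2 (Equiv.Perm.sameCycle_apply_left.2 (Equiv.Perm.SameCycle.refl _ _))

lemma InWn.orbitOf_negMap {n : ℕ} {τ : Equiv.Perm (Fin (2*n))} (hτ : InWn n τ)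
    (x : Fin (2*n)) : orbitOf τ (negMap n x) = negSet n (orbitOf τ x) := by
  ext y
  constructor
  · intro h
    refine ⟨negMap n y, ?_, negMap_negMap y⟩
    have := hτ.sameCycle_negMap h
    rwa [negMap_negMap] at this
  · rintro ⟨z, hz, rfl⟩
    exact hτ.sameCycle_negMap hz

/-- There is an odd orbit function with values in `{0, 1, -1}` that vanishes exactly on the
inversion-invariant orbits. -/
lemma InWn.exists_sign {n : ℕ} {τ : Equiv.Perm (Fin (2*n))} (hτ : InWn n τ) :
    ∃ e ∈ fixedSpace n (-1) τ,
      (∀ x, negSet n (orbitOf τ x) = orbitOf τ x → e x = 0) ∧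
      ∀ x, negSet n (orbitOf τ x) ≠ orbitOf τ x → e x * e x = 1 := by
  obtain ⟨r, hr⟩ := Countable.exists_injective_nat (Set (Fin (2*n)))
  refine ⟨fun x => ((SignType.sign ((r (orbitOf τ (negMap n x)) : ℚ) - r (orbitOf τ x)) :
    SignType) : ℚ), ⟨fun x => ?_, fun x => ?_⟩, fun x hx => ?_, fun x hx => ?_⟩
  · simp only [← hτ x, orbitOf_apply]
  · simp only [negMap_negMap]
    rw [← neg_sub, Left.sign_neg]
    simp
  · simp [hτ.orbitOf_negMap, hx]
  · rw [← hτ.orbitOf_negMap] at hx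
    have : (r (orbitOf τ (negMap n x)) : ℚ) - r (orbitOf τ x) ≠ 0 := by
      rw [sub_ne_zero]
      exact_mod_cast hr.ne hx
    rcases this.lt_or_gt with h | h
    · simp [sign_neg h]
    · simp [sign_pos h]

lemma finrank_fixedSpace_eq {n : ℕ} {τ : Equiv.Perm (Fin (2*n))} (hτ : InWn n τ) :
    Module.finrank ℚ (fixedSpace n 1 τ) = Module.finrank ℚ (fixedSpace n (-1) τ) +
      {O | O ∈ orbitsOf n τ ∧ negSet n O = O}.ncard := by
  obtain ⟨e, he, he0, he1⟩ := hτ.exists_sign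
  let I : Set (Set (Fin (2*n))) := {O | O ∈ orbitsOf n τ ∧ negSet n O = O}
  have hI : ∀ x, orbitOf τ x ∈ I ↔ negSet n (orbitOf τ x) = orbitOf τ x := fun x =>
    ⟨fun h => h.2, fun h => ⟨⟨x, rfl⟩, h⟩⟩
  have hneg : ∀ g ∈ fixedSpace n (-1) τ, ∀ x, orbitOf τ x ∈ I → g x = 0 := by
    intro g hg x hx
    rw [hI, ← hτ.orbitOf_negMap, orbitOf_eq_iff] at hx
    have h1 := apply_eq_of_sameCycle hg.1 hx
    rw [hg.2] at h1
    linarith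
  let Φ : fixedSpace n 1 τ →ₗ[ℚ] fixedSpace n (-1) τ :=
    { toFun := fun f => ⟨fun x => e x * f.1 x, fun x => by simp only [he.1, f.2.1],
        fun x => by simp only [he.2, f.2.2]; ring⟩
      map_add' := fun f g => by ext x; simp [mul_add]
      map_smul' := fun c f => by ext x; simp [mul_left_comm] }
  have hΦ : Function.Surjective Φ := by
    intro g
    refine ⟨⟨fun x => e x * g.1 x, fun x => by simp only [he.1, g.2.1],
      fun x => by simp only [he.2, g.2.2]; ring⟩, Subtype.ext (funext fun x => ?_)⟩
    change e x * (e x * g.1 x) = g.1 x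
    by_cases hx : orbitOf τ x ∈ I
    · rw [hneg g.1 g.2 x hx, mul_zero, mul_zero]
    · rw [← mul_assoc, he1 x (mt (hI x).2 hx), one_mul]
  let Ψ : (I → ℚ) →ₗ[ℚ] (fixedSpace n 1 τ) :=
    { toFun := fun h => ⟨fun x => if hx : orbitOf τ x ∈ I then h ⟨_, hx⟩ else 0,
        fun x => by simp only [orbitOf_apply],
        fun x => by
          by_cases hx : orbitOf τ x ∈ I
          · have : orbitOf τ (negMap n x) = orbitOf τ x := by rw [hτ.orbitOf_negMap, hx.2]
            simp only [this, one_mul]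
          · have : orbitOf τ (negMap n x) ∉ I := by
              intro h'
              apply hx
              rw [hI, ← hτ.orbitOf_negMap] at h' ⊢
              rw [negMap_negMap] at h'
              exact h'.symm
            simp only [dif_neg hx, dif_neg this, mul_zero]⟩
      map_add' := fun f g => by
        ext x
        by_cases hx : orbitOf τ x ∈ I <;> simp [hx]
      map_smul' := fun c f => by
        ext x
        by_cases hx : orbitOf τ x ∈ I <;> simp [hx] }
  have hΨ : Function.Injective Ψ := by
    intro f g h
    funext O
    obtain ⟨O, ⟨x, rfl⟩, hO⟩ := O
    have hx : orbitOf τ x ∈ I := ⟨⟨x, rfl⟩, hO⟩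
    have h := congrFun (congrArg Subtype.val h) x
    change (if hx : orbitOf τ x ∈ I then f ⟨_, hx⟩ else 0) =
      (if hx : orbitOf τ x ∈ I then g ⟨_, hx⟩ else 0) at h
    rwa [dif_pos hx, dif_pos hx] at h
  have hker : LinearMap.ker Φ = LinearMap.range Ψ := by
    ext f
    constructor
    · intro hf
      have hf : ∀ x, e x * f.1 x = 0 := fun x => congrFun (congrArg Subtype.val hf) x
      have hrep : ∀ O : I, ∃ x, O.1 = orbitOf τ x := fun O => O.2.1
      choose q hq using hrep
      refine ⟨fun O => f.1 (q O), Subtype.ext (funext fun x => ?_)⟩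
      change (if hx : orbitOf τ x ∈ I then f.1 (q ⟨_, hx⟩) else 0) = f.1 x
      by_cases hx : orbitOf τ x ∈ I
      · rw [dif_pos hx]
        exact (apply_eq_of_sameCycle f.2.1 (orbitOf_eq_iff.1 (hq ⟨_, hx⟩))).symm
      · rw [dif_neg hx]
        have := he1 x (mt (hI x).2 hx)
        rcases mul_eq_zero.1 (hf x) with h | h
        · simp [h] at this
        · exact h.symm
    · rintro ⟨h, rfl⟩
      refine Subtype.ext (funext fun x => ?_)
      change e x * (if hx : orbitOf τ x ∈ I then h ⟨_, hx⟩ else 0) = 0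
      by_cases hx : orbitOf τ x ∈ I
      · rw [he0 x hx.2, zero_mul]
      · rw [dif_neg hx, mul_zero]
  have h1 := LinearMap.finrank_range_add_finrank_ker Φ
  rw [LinearMap.range_eq_top.2 hΦ, finrank_top, hker, LinearMap.finrank_range_of_inj hΨ,
    Module.finrank_fintype_fun_eq_card, ← Nat.card_eq_fintype_card, Nat.card_coe_set_eq] at h1
  exact h1.symm

end NCPB

open NCPB in
/-- If `τ₁ ≤ τ₂` in `W_n`, then `τ₂` has at least as many
inversion-invariant orbits as `τ₁`. -/
theorem card_invOrbits_le_of_leB (n : ℕ) (hn : 0 < n)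
    (τ₁ τ₂ : Equiv.Perm (Fin (2*n))) (h1 : InWn n τ₁) (h2 : InWn n τ₂)
    (hle : leB n τ₁ τ₂) :
    {O | O ∈ orbitsOf n τ₁ ∧ negSet n O = O}.ncard ≤
      {O | O ∈ orbitsOf n τ₂ ∧ negSet n O = O}.ncard := by
  have hσ : InWn n (τ₁⁻¹ * τ₂) := h1.inv.mul h2
  have hsub := finrank_fixedSpace_add_le 1 τ₁ (τ₁⁻¹ * τ₂)
  rw [mul_inv_cancel_left] at hsub
  have hlow := finrank_fixedSpace_one_le (-1) h1
  have hlowσ := finrank_fixedSpace_one_le 1 hσ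
  have hup := lenB_add_finrank_le h2
  have e1 := finrank_fixedSpace_eq h1
  have e2 := finrank_fixedSpace_eq h2
  unfold leB at hle
  omega
end
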